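/- Let A and B be p×p Hermitian positive semidefinite complex matrices, let 1 ≤ d < p, and assume λ_d(A) > λ_{d+1}(A), λ_d(B) > λ_{d+1}(B), and λ_d(A) > λ_{d+1}(B). Let Π_A (resp. Π_B) be the orthogonal projection onto the sum of the eigenspaces of A (resp. B) corresponding to its d largest eigenvalues. Then ‖Π_A − Π_B‖_F ≤ √(2d) · ‖A − B‖_op / (λ_d(A) − λ_{d+1}(B)). -/

import Mathlib

open Matrix ComplexOrder

/-- Frobenius norm `‖A‖_F = √(tr(A†A))`. -/
noncomputable def frob {m n : Type*} [Fintype m] [Fintype n]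
    (A : Matrix m n ℂ) : ℝ := Real.sqrt ((Matrix.trace (Aᴴ * A)).re)

/-- Operator norm (largest singular value) of a complex matrix. -/
noncomputable def opNorm {m n : Type*} [Fintype m] [Fintype n] [DecidableEq n]
    (A : Matrix m n ℂ) : ℝ :=
  ‖LinearMap.toContinuousLinearMap (Matrix.toEuclideanLin A)‖

section

open scoped Matrix.Norms.L2Operator

lemma opNorm_eq_norm {m n : Type*} [Fintype m] [Fintype n] [DecidableEq n]
    (A : Matrix m n ℂ) : opNorm A = ‖A‖ := by
  rw [Matrix.l2_opNorm_def]
  rfl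

lemma frob_eq_sqrt_sum {m n : Type*} [Fintype m] [Fintype n] (A : Matrix m n ℂ) :
    frob A = √(∑ i, ∑ j, ‖A i j‖ ^ 2) := by
  rw [frob, Finset.sum_comm]
  simp [Matrix.trace, Matrix.mul_apply, Complex.sq_norm, Complex.normSq_apply]

lemma frob_conjTranspose_mul_mul {n : Type*} [Fintype n] [DecidableEq n]
    {U V : Matrix n n ℂ} (hU : U ∈ Matrix.unitaryGroup n ℂ) (hV : V ∈ Matrix.unitaryGroup n ℂ)
    (A : Matrix n n ℂ) : frob (Uᴴ * A * V) = frob A := by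
  have hU' : U * Uᴴ = 1 := Matrix.mem_unitaryGroup_iff.mp hU
  have hV' : V * Vᴴ = 1 := Matrix.mem_unitaryGroup_iff.mp hV
  have h : (Uᴴ * A * V)ᴴ * (Uᴴ * A * V) = Vᴴ * (Aᴴ * A * V) := by
    calc (Uᴴ * A * V)ᴴ * (Uᴴ * A * V) = Vᴴ * (Aᴴ * (U * Uᴴ) * A * V) := by
          simp only [Matrix.conjTranspose_mul, Matrix.conjTranspose_conjTranspose,
            Matrix.mul_assoc]
      _ = Vᴴ * (Aᴴ * A * V) := by rw [hU', Matrix.mul_one]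
  rw [frob, frob, h, Matrix.trace_mul_comm, Matrix.mul_assoc, hV', Matrix.mul_one]

lemma norm_conjTranspose_mul_mul {n : Type*} [Fintype n] [DecidableEq n]
    {U V : Matrix n n ℂ} (hU : U ∈ Matrix.unitaryGroup n ℂ) (hV : V ∈ Matrix.unitaryGroup n ℂ)
    (A : Matrix n n ℂ) : ‖Uᴴ * A * V‖ = ‖A‖ := by
  rw [CStarRing.norm_mul_mem_unitary _ hV]
  exact CStarRing.norm_mem_unitary_mul A (Unitary.star_mem hU)

lemma sum_norm_sq_col_le {m n : Type*} [Fintype m] [Fintype n] [DecidableEq n]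
    (A : Matrix m n ℂ) (j : n) : ∑ i, ‖A i j‖ ^ 2 ≤ ‖A‖ ^ 2 := by
  have h := Matrix.l2_opNorm_mulVec A (EuclideanSpace.single j (1 : ℂ))
  rw [PiLp.norm_single, norm_one, mul_one] at h
  have h2 := pow_le_pow_left₀ (norm_nonneg _) h 2
  rw [EuclideanSpace.norm_sq_eq] at h2
  simpa using h2

lemma sum_norm_sq_row_le {m n : Type*} [Fintype m] [Fintype n] [DecidableEq m] [DecidableEq n]
    (A : Matrix m n ℂ) (i : m) : ∑ j, ‖A i j‖ ^ 2 ≤ ‖A‖ ^ 2 := by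
  simpa [Matrix.l2_opNorm_conjTranspose] using sum_norm_sq_col_le Aᴴ i

lemma sum_norm_sq_row_of_mem_unitaryGroup {n : Type*} [Fintype n] [DecidableEq n]
    {U : Matrix n n ℂ} (hU : U ∈ Matrix.unitaryGroup n ℂ) (i : n) :
    ∑ j, ‖U i j‖ ^ 2 = 1 := by
  have h := congrFun (congrFun (Matrix.mem_unitaryGroup_iff.mp hU) i) i
  rw [Matrix.mul_apply, Matrix.one_apply_eq] at h
  simp only [Matrix.star_apply, RCLike.star_def, Complex.mul_conj'] at h
  exact_mod_cast h

lemma sum_norm_sq_col_of_mem_unitaryGroup {n : Type*} [Fintype n] [DecidableEq n]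
    {U : Matrix n n ℂ} (hU : U ∈ Matrix.unitaryGroup n ℂ) (j : n) :
    ∑ i, ‖U i j‖ ^ 2 = 1 := by
  simpa [Matrix.star_apply] using
    sum_norm_sq_row_of_mem_unitaryGroup (Unitary.star_mem hU) j

/-- The two off-diagonal blocks of a unitary matrix have the same Frobenius norm. -/
lemma sum_offDiag_block_comm {n : Type*} [Fintype n] [DecidableEq n]
    {U : Matrix n n ℂ} (hU : U ∈ Matrix.unitaryGroup n ℂ) (S : Finset n) :
    ∑ i ∈ Sᶜ, ∑ j ∈ S, ‖U i j‖ ^ 2 = ∑ i ∈ S, ∑ j ∈ Sᶜ, ‖U i j‖ ^ 2 := by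
  have hrow : ∑ i ∈ S, ∑ j ∈ S, ‖U i j‖ ^ 2 + ∑ i ∈ S, ∑ j ∈ Sᶜ, ‖U i j‖ ^ 2 = S.card := by
    simp [← Finset.sum_add_distrib, Finset.sum_add_sum_compl,
      sum_norm_sq_row_of_mem_unitaryGroup hU]
  have hcol : ∑ i ∈ S, ∑ j ∈ S, ‖U i j‖ ^ 2 + ∑ i ∈ Sᶜ, ∑ j ∈ S, ‖U i j‖ ^ 2 = S.card := by
    rw [Finset.sum_add_sum_compl, Finset.sum_comm]
    simp [sum_norm_sq_col_of_mem_unitaryGroup hU]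
  linarith

lemma conjTranspose_mul_sub_mul_apply {n : Type*} [Fintype n] [DecidableEq n]
    {U V : Matrix n n ℂ} (hU : U ∈ Matrix.unitaryGroup n ℂ) (hV : V ∈ Matrix.unitaryGroup n ℂ)
    (a b : n → ℂ) (i j : n) :
    (Uᴴ * (U * Matrix.diagonal a * Uᴴ - V * Matrix.diagonal b * Vᴴ) * V) i j =
      (a i - b j) * (Uᴴ * V) i j := by
  have hU' : Uᴴ * U = 1 := Matrix.mem_unitaryGroup_iff'.mp hU
  have hV' : Vᴴ * V = 1 := Matrix.mem_unitaryGroup_iff'.mp hV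
  have h : Uᴴ * (U * Matrix.diagonal a * Uᴴ - V * Matrix.diagonal b * Vᴴ) * V =
      Matrix.diagonal a * (Uᴴ * V) - Uᴴ * V * Matrix.diagonal b := by
    calc _ = (Uᴴ * U) * Matrix.diagonal a * (Uᴴ * V)
            - Uᴴ * V * Matrix.diagonal b * (Vᴴ * V) := by
          simp only [Matrix.mul_sub, Matrix.sub_mul, Matrix.mul_assoc]
      _ = _ := by rw [hU', hV', Matrix.one_mul, Matrix.mul_one]
  rw [h, Matrix.sub_apply, Matrix.diagonal_mul, Matrix.mul_diagonal]
  ring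

/-- The squared Frobenius distance of two spectral projections of the same rank is twice the
squared Frobenius norm of an off-diagonal block of the change of basis. -/
lemma frob_sub_eq_sqrt_two_mul_sum {n : Type*} [Fintype n] [DecidableEq n]
    {U V : Matrix n n ℂ} (hU : U ∈ Matrix.unitaryGroup n ℂ) (hV : V ∈ Matrix.unitaryGroup n ℂ)
    (S : Finset n) :
    frob (U * Matrix.diagonal (fun i => if i ∈ S then (1 : ℂ) else 0) * Uᴴ -
        V * Matrix.diagonal (fun i => if i ∈ S then (1 : ℂ) else 0) * Vᴴ) =
      √(2 * ∑ i ∈ S, ∑ j ∈ Sᶜ, ‖(Uᴴ * V) i j‖ ^ 2) := by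
  have hW : Uᴴ * V ∈ Matrix.unitaryGroup n ℂ := mul_mem (Unitary.star_mem hU) hV
  rw [← frob_conjTranspose_mul_mul hU hV, frob_eq_sqrt_sum]
  simp only [conjTranspose_mul_sub_mul_apply hU hV]
  congr 1
  rw [two_mul]
  nth_rewrite 2 [← sum_offDiag_block_comm hW S]
  rw [← Finset.sum_add_sum_compl S]
  congr 1
  · refine Finset.sum_congr rfl fun i hi => ?_
    rw [← Finset.sum_add_sum_compl S, Finset.sum_eq_zero, zero_add]
    · refine Finset.sum_congr rfl fun j hj => ?_
      simp [hi, Finset.mem_compl.mp hj]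
    · intro j hj
      simp [hi, hj]
  · refine Finset.sum_congr rfl fun i hi => ?_
    rw [← Finset.sum_add_sum_compl S, add_comm, Finset.sum_eq_zero, zero_add]
    · refine Finset.sum_congr rfl fun j hj => ?_
      simp [Finset.mem_compl.mp hi, hj]
    · intro j hj
      simp [Finset.mem_compl.mp hi, Finset.mem_compl.mp hj]

lemma sq_mul_sum_le_card_mul_norm_sq {n : Type*} [Fintype n] [DecidableEq n]
    {U V : Matrix n n ℂ} (hU : U ∈ Matrix.unitaryGroup n ℂ) (hV : V ∈ Matrix.unitaryGroup n ℂ)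
    (a b : n → ℝ) {S : Finset n} {δ : ℝ} (hδ : 0 ≤ δ)
    (hgap : ∀ i ∈ S, ∀ j ∈ Sᶜ, δ ≤ a i - b j) :
    δ ^ 2 * ∑ i ∈ S, ∑ j ∈ Sᶜ, ‖(Uᴴ * V) i j‖ ^ 2 ≤
      S.card * ‖U * Matrix.diagonal (fun i => (a i : ℂ)) * Uᴴ -
        V * Matrix.diagonal (fun i => (b i : ℂ)) * Vᴴ‖ ^ 2 := by
  rw [← norm_conjTranspose_mul_mul hU hV, Finset.mul_sum, ← nsmul_eq_mul]
  refine Finset.sum_le_card_nsmul _ _ _ fun i hi => ?_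
  refine le_trans ?_ (sum_norm_sq_row_le _ i)
  rw [Finset.mul_sum]
  refine le_trans (Finset.sum_le_sum fun j hj => ?_)
    (Finset.sum_le_univ_sum_of_nonneg (s := Sᶜ) fun j => by positivity)
  rw [conjTranspose_mul_sub_mul_apply hU hV, norm_mul, mul_pow, ← Complex.ofReal_sub,
    Complex.norm_real, Real.norm_eq_abs, sq_abs]
  gcongr
  exact hgap i hi j hj

end

/-- Davis–Kahan type bound: for Hermitian PSD matrices `A, B` with eigenvalues
`μA, μB` listed in nonincreasing order, eigengaps `λ_d(A) > λ_{d+1}(A)`,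
`λ_d(B) > λ_{d+1}(B)` and `λ_d(A) > λ_{d+1}(B)`, and `ΠA, ΠB` the orthogonal projections
onto the respective top-`d` eigenspaces, one has
`‖ΠA − ΠB‖_F ≤ √(2d) ‖A − B‖_op / (λ_d(A) − λ_{d+1}(B))`. -/
theorem davis_kahan_bound {p d : ℕ} (hd : 1 ≤ d) (hdp : d < p)
    (A B : Matrix (Fin p) (Fin p) ℂ) (hA : A.PosSemidef) (hB : B.PosSemidef)
    (μA μB : Fin p → ℝ) (hμA : Antitone μA) (hμB : Antitone μB)
    (VA VB : Matrix (Fin p) (Fin p) ℂ)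
    (hVA : VA ∈ Matrix.unitaryGroup (Fin p) ℂ) (hVB : VB ∈ Matrix.unitaryGroup (Fin p) ℂ)
    (hAdiag : A = VA * Matrix.diagonal (fun i => (μA i : ℂ)) * VAᴴ)
    (hBdiag : B = VB * Matrix.diagonal (fun i => (μB i : ℂ)) * VBᴴ)
    (hgapA : μA ⟨d, hdp⟩ < μA ⟨d - 1, by omega⟩)
    (hgapB : μB ⟨d, hdp⟩ < μB ⟨d - 1, by omega⟩)
    (hgapAB : μB ⟨d, hdp⟩ < μA ⟨d - 1, by omega⟩)
    (PA PB : Matrix (Fin p) (Fin p) ℂ)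
    (hPA : PA = VA * Matrix.diagonal (fun i : Fin p => if (i : ℕ) < d then (1 : ℂ) else 0) * VAᴴ)
    (hPB : PB = VB * Matrix.diagonal (fun i : Fin p => if (i : ℕ) < d then (1 : ℂ) else 0) * VBᴴ) :
    frob (PA - PB) ≤
      Real.sqrt (2 * d) * opNorm (A - B) / (μA ⟨d - 1, by omega⟩ - μB ⟨d, hdp⟩) := by
  have hδ : 0 < μA ⟨d - 1, by omega⟩ - μB ⟨d, hdp⟩ := sub_pos.mpr hgapAB
  set δ := μA ⟨d - 1, by omega⟩ - μB ⟨d, hdp⟩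
  let S : Finset (Fin p) := {i | (i : ℕ) < d}
  have hS : S.card = d := by
    simp [S, Fin.card_filter_val_lt, hdp.le]
  have hfrob := frob_sub_eq_sqrt_two_mul_sum hVA hVB S
  simp only [S, Finset.mem_filter_univ] at hfrob
  rw [← hPA, ← hPB] at hfrob
  have hle := sq_mul_sum_le_card_mul_norm_sq hVA hVB μA μB (S := S) hδ.le fun i hi j hj => by
    simp only [S, Finset.mem_filter_univ, Finset.mem_compl, not_lt] at hi hj
    exact sub_le_sub (hμA (Fin.mk_le_mk.mpr (by omega))) (hμB (Fin.mk_le_mk.mpr hj))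
  rw [← hAdiag, ← hBdiag, hS, ← opNorm_eq_norm] at hle
  rw [hfrob]
  refine Real.sqrt_le_iff.mpr ⟨div_nonneg (mul_nonneg (Real.sqrt_nonneg _) (norm_nonneg _)) hδ.le, ?_⟩
  rw [div_pow, mul_pow, Real.sq_sqrt (by positivity), le_div_iff₀ (by positivity)]
  linarith
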